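/- Let m ≥ 1 be an integer and Y any type. For partitions π₁ and π₂ of m, W_{π₁}(Y) ∩ W_{π₂}(Y) = ⋃_π W_π(Y), where π ranges over all partitions of m with π ≥ π₁ and π ≥ π₂ (common coarsenings of π₁ and π₂). -/

import Mathlib

open Multiset

/-- `W π Y` is the set of multisets `a_1•{y_1} + ⋯ + a_k•{y_k}` in `Sym Y m`,
where `(a_1,…,a_k)` are the parts of the partition `π` of `m`. -/
def W {m : ℕ} (π : Nat.Partition m) (Y : Type*) : Set (Sym Y m) :=
  {s | ∃ t : Multiset (ℕ × Y), t.map Prod.fst = π.parts ∧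
        (t.map fun p => Multiset.replicate p.1 p.2).sum = s.1}


/-- `Coarsens π π′` means `π ≥ π′`, i.e. `π′` refines `π`: the parts of `π′` can be
grouped (by a surjection on the index sets of parts) so that each group sums to the
corresponding part of `π`.  Encoded via a multiset `t` of groups of parts. -/
def Coarsens {m : ℕ} (π π' : Nat.Partition m) : Prop :=
  ∃ t : Multiset (Multiset ℕ), t.map Multiset.sum = π.parts ∧ t.sum = π'.parts


/-- Two multisets whose images under `f` and `g` agree can be paired up compatibly. -/
theorem exists_pairing_of_map_eq_map {α β γ : Type*} {f : α → γ} {g : β → γ}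
    {s : Multiset α} {t : Multiset β} (h : s.map f = t.map g) :
    ∃ v : Multiset (α × β), v.map Prod.fst = s ∧ v.map Prod.snd = t ∧
      ∀ p ∈ v, f p.1 = g p.2 := by
  have hrel : Multiset.Rel (fun a b => f a = g b) s t := by
    rw [← Multiset.rel_eq, Multiset.rel_map] at h
    exact h
  clear h
  induction hrel with
  | zero => exact ⟨0, by simp⟩
  | @cons a b s t hab _ ih =>
    obtain ⟨v, rfl, rfl, hv⟩ := ih
    refine ⟨(a, b) ::ₘ v, by simp, by simp, fun p hp => ?_⟩
    rcases Multiset.mem_cons.1 hp with rfl | hp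
    · exact hab
    · exact hv p hp

theorem sum_map_replicate {Y : Type*} (g : Multiset ℕ) (y : Y) :
    (g.map fun a => Multiset.replicate a y).sum = Multiset.replicate g.sum y := by
  induction g using Multiset.induction_on with
  | empty => simp
  | cons a g ih => simp [ih, Multiset.replicate_add]

theorem W_subset_of_coarsens {m : ℕ} {π π' : Nat.Partition m} (h : Coarsens π π')
    (Y : Type*) : W π Y ⊆ W π' Y := by
  rintro s ⟨u, hu, hs⟩
  obtain ⟨t, ht, ht'⟩ := h
  obtain ⟨v, rfl, rfl, hv⟩ := exists_pairing_of_map_eq_map (ht.trans hu.symm)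
  refine ⟨v.bind fun p => p.1.map fun a => (a, p.2.2), ?_, ?_⟩
  · rw [← ht', Multiset.map_bind, Multiset.bind]
    simp [Multiset.join]
  · rw [← hs, Multiset.map_bind, Multiset.sum_bind, Multiset.map_map]
    congr 1
    refine Multiset.map_congr rfl fun p hp => ?_
    simp [sum_map_replicate, hv p hp]

/-- Grouping a multiset of pairs by second component and summing the groups
of first components recovers all first components. -/
theorem sum_map_fst_filter_snd {α Y : Type*} [DecidableEq Y] (S : Finset Y)
    (t : Multiset (α × Y)) (h : ∀ p ∈ t, p.2 ∈ S) :
    ∑ y ∈ S, (t.filter fun p => p.2 = y).map Prod.fst = t.map Prod.fst := by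
  induction t using Multiset.induction_on with
  | empty => simp
  | cons p t ih =>
    have hp := h p (Multiset.mem_cons_self p t)
    have ih := ih fun q hq => h q (Multiset.mem_cons_of_mem hq)
    simp only [Multiset.filter_cons, Multiset.map_add, Finset.sum_add_distrib, ih,
      Multiset.map_cons]
    simp [apply_ite (Multiset.map Prod.fst), hp]

theorem count_sum_map_replicate {Y : Type*} [DecidableEq Y] (t : Multiset (ℕ × Y)) (y : Y) :
    (t.map fun p => Multiset.replicate p.1 p.2).sum.count y =
      ((t.filter fun p => p.2 = y).map Prod.fst).sum := by
  induction t using Multiset.induction_on with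
  | empty => simp
  | cons p t ih =>
    by_cases hp : p.2 = y <;> simp [ih, Multiset.count_replicate, hp]

/-- The partition of `m` given by the multiplicities of the elements of `s`. -/
def multiplicityPartition {m : ℕ} {Y : Type*} [DecidableEq Y] (s : Sym Y m) :
    Nat.Partition m where
  parts := s.1.toFinset.val.map fun y => s.1.count y
  parts_pos := by
    intro i hi
    obtain ⟨y, hy, rfl⟩ := Multiset.mem_map.1 hi
    exact Multiset.count_pos.2 (Multiset.mem_toFinset.1 hy)
  parts_sum := (Multiset.toFinset_sum_count_eq s.1).trans s.2

theorem mem_W_multiplicityPartition {m : ℕ} {Y : Type*} [DecidableEq Y] (s : Sym Y m) :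
    s ∈ W (multiplicityPartition s) Y := by
  refine ⟨s.1.toFinset.val.map fun y => (s.1.count y, y), ?_, ?_⟩
  · simp [multiplicityPartition]
  · rw [Multiset.map_map]
    refine Eq.trans ?_ (Multiset.toFinset_sum_count_nsmul_eq s.1)
    simp only [Multiset.nsmul_singleton]
    rfl

theorem multiplicityPartition_coarsens {m : ℕ} {Y : Type*} [DecidableEq Y]
    {π : Nat.Partition m} {s : Sym Y m} (h : s ∈ W π Y) :
    Coarsens (multiplicityPartition s) π := by
  obtain ⟨t, ht, hs⟩ := h
  refine ⟨s.1.toFinset.val.map fun y => (t.filter fun p => p.2 = y).map Prod.fst, ?_, ?_⟩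
  · rw [Multiset.map_map]
    refine Multiset.map_congr rfl fun y _ => ?_
    rw [← hs, count_sum_map_replicate, Function.comp_apply]
  · rw [← ht]
    refine sum_map_fst_filter_snd _ t fun p hp => ?_
    have hpos : 0 < p.1 := π.parts_pos (ht ▸ Multiset.mem_map_of_mem Prod.fst hp)
    rw [Multiset.mem_toFinset, ← hs]
    exact Multiset.mem_of_le
      (Multiset.le_sum_of_mem (Multiset.mem_map_of_mem _ hp))
      (Multiset.mem_replicate.2 ⟨hpos.ne', rfl⟩)

/-- `W_{π₁}(Y) ∩ W_{π₂}(Y)` is the union of the `W_π(Y)` over all common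
coarsenings `π` of `π₁` and `π₂`. -/
theorem W_inter_W_eq_iUnion (m : ℕ) (hm : 1 ≤ m) (Y : Type*)
    (π₁ π₂ : Nat.Partition m) :
    W π₁ Y ∩ W π₂ Y =
      ⋃ (π : Nat.Partition m) (_ : Coarsens π π₁ ∧ Coarsens π π₂), W π Y := by
  classical
  ext s
  simp only [Set.mem_inter_iff, Set.mem_iUnion]
  constructor
  · rintro ⟨h₁, h₂⟩
    exact ⟨multiplicityPartition s, ⟨multiplicityPartition_coarsens h₁,
      multiplicityPartition_coarsens h₂⟩, mem_W_multiplicityPartition s⟩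
  · rintro ⟨π, ⟨h₁, h₂⟩, hs⟩
    exact ⟨W_subset_of_coarsens h₁ Y hs, W_subset_of_coarsens h₂ Y hs⟩
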